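/- (Rank evolution.) In the Laplacian model, for every sufficiently small δ > 0 there exist constants C, c > 0 (depending on p, q, α, δ) such that for all n and every integer k with 1 ≤ k ≤ δn the following holds. Let W be the F_p-span of the first (1+α)n − k rows of M and let Y be row (1+α)n − k + 1 of M. There is an event E, measurable with respect to the first (1+α)n − k rows of M, with P(E) ≥ 1 − C·exp(−cn), such that for every integer l ≥ 1 for which the event E ∩ {W has codimension l in F_p^{(1+α)n}} has positive probability, |P(Y ∈ W | E ∩ {W has codimension l}) − p^{−(l−1)}| ≤ C·exp(−cn). -/

import Mathlib

open MeasureTheory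

instance zmodMeasurableSpace (n : ℕ) : MeasurableSpace (ZMod n) := ⊤

/-- The Bernoulli-type measure on `ZMod p`: value `1` with probability `q`,
value `0` with probability `1 - q`. -/
noncomputable def bern (p : ℕ) (q : ℝ) : Measure (ZMod p) :=
  ENNReal.ofReal q • Measure.dirac 1 + ENNReal.ofReal (1 - q) • Measure.dirac 0

instance bern_isFiniteMeasure (p : ℕ) (q : ℝ) : IsFiniteMeasure (bern p q) := by
  constructor
  simp [bern]

/-- Index type for the independent edge indicators of the random directed bipartite graph. -/
abbrev LapIdx (n a : ℕ) := Fin n × Fin a ⊕ Fin a × Fin n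

/-- The product (Bernoulli) measure on the space of edge indicators. -/
noncomputable def lapMeasure (p n a : ℕ) (q : ℝ) : Measure (LapIdx n a → ZMod p) :=
  Measure.pi fun _ => bern p q

/-- The Laplacian of the random directed bipartite graph on parts of sizes `n` and `a`,
as a function of the edge indicators `ω`. -/
def lapM (p n a : ℕ) (ω : LapIdx n a → ZMod p) :
    Matrix (Fin (n + a)) (Fin (n + a)) (ZMod p) := fun i j =>
  if hi : (i : ℕ) < n then
    if hj : (j : ℕ) < n then
      (if (i : ℕ) = (j : ℕ) then -∑ k : Fin a, ω (Sum.inl (⟨i, hi⟩, k)) else 0)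
    else ω (Sum.inl (⟨i, hi⟩, ⟨(j : ℕ) - n, by have := j.isLt; omega⟩))
  else
    if hj : (j : ℕ) < n then
      ω (Sum.inr (⟨(i : ℕ) - n, by have := i.isLt; omega⟩, ⟨j, hj⟩))
    else
      (if (i : ℕ) = (j : ℕ) then
        -∑ k : Fin n, ω (Sum.inr (⟨(i : ℕ) - n, by have := i.isLt; omega⟩, k)) else 0)

/-- The submatrix consisting of the first `m` rows of the Laplacian. -/
def firstRows (p n a m : ℕ) (h : m ≤ n + a) (ω : LapIdx n a → ZMod p) :
    Matrix (Fin m) (Fin (n + a)) (ZMod p) :=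
  fun i j => lapM p n a ω (Fin.castLE h i) j

/-- The span of the first `m` rows of the Laplacian. -/
def rowSpan (p n a m : ℕ) (h : m ≤ n + a) (ω : LapIdx n a → ZMod p) :
    Submodule (ZMod p) (Fin (n + a) → ZMod p) :=
  Submodule.span (ZMod p) (Set.range (firstRows p n a m h ω))

/-! ### The product Bernoulli measure on a finite index set -/

instance zmod_discreteMeasurableSpace (n : ℕ) : DiscreteMeasurableSpace (ZMod n) := ⟨fun _ => trivial⟩

/-- The law of a family of independent `bern p q` variables. -/
noncomputable abbrev bernPi (p : ℕ) (q : ℝ) (ι : Type) [Fintype ι] : Measure (ι → ZMod p) :=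
  Measure.pi fun _ => bern p q

/-- The mass function of `bern p q`. -/
noncomputable def bernWeight (p : ℕ) (q : ℝ) (z : ZMod p) : ℝ :=
  (if z = 1 then q else 0) + (if z = 0 then 1 - q else 0)

section BernPi

variable {p : ℕ} {q : ℝ} {ι κ : Type} [Fintype ι] [Fintype κ]

theorem bern_isProbabilityMeasure (hq0 : 0 ≤ q) (hq1 : q ≤ 1) : IsProbabilityMeasure (bern p q) := by
  constructor
  rw [bern]
  simp only [Measure.coe_add, Measure.coe_smul, Pi.add_apply, Pi.smul_apply, measure_univ,
    smul_eq_mul, mul_one]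
  rw [← ENNReal.ofReal_add hq0 (by linarith)]
  simp

theorem bern_real_singleton (hq0 : 0 ≤ q) (hq1 : q ≤ 1) (z : ZMod p) :
    (bern p q).real {z} = bernWeight p q z := by
  rw [Measure.real, bern, bernWeight]
  simp only [Measure.coe_add, Measure.coe_smul, Pi.add_apply, Pi.smul_apply,
    Measure.dirac_apply, smul_eq_mul, Set.indicator_apply, Set.mem_singleton_iff]
  rw [ENNReal.toReal_add (by split_ifs <;> simp) (by split_ifs <;> simp)]
  have h1 : 0 ≤ 1 - q := by linarith
  simp only [eq_comm (a := (1 : ZMod p)), eq_comm (a := (0 : ZMod p))]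
  split_ifs <;> simp [hq0, h1]

theorem bernWeight_nonneg (hq0 : 0 ≤ q) (hq1 : q ≤ 1) (z : ZMod p) : 0 ≤ bernWeight p q z := by
  rw [← bern_real_singleton hq0 hq1]
  exact measureReal_nonneg

theorem sum_bernWeight_mul [Fact p.Prime] {R : Type*} [Semiring R] [Algebra ℝ R]
    (f : ZMod p → R) :
    ∑ z, algebraMap ℝ R (bernWeight p q z) * f z =
      algebraMap ℝ R q * f 1 + algebraMap ℝ R (1 - q) * f 0 := by
  simp only [bernWeight, map_add, add_mul, Finset.sum_add_distrib, apply_ite (algebraMap ℝ R),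
    map_zero, ite_mul, zero_mul, Finset.sum_ite_eq', Finset.mem_univ, if_true]

theorem sum_prod_bernWeight [Fact p.Prime] [DecidableEq ι] :
    ∑ ω : ι → ZMod p, ∏ i, bernWeight p q (ω i) = 1 := by
  have h := Finset.prod_univ_sum (fun _ : ι => (Finset.univ : Finset (ZMod p)))
    (fun _ z => bernWeight p q z)
  rw [Fintype.piFinset_univ] at h
  rw [← h]
  have h2 := sum_bernWeight_mul (p := p) (q := q) (R := ℝ) (fun _ => 1)
  simp at h2
  simp [h2]

theorem bernPi_real_eq_sum [Fact p.Prime] [DecidableEq ι] (hq0 : 0 ≤ q) (hq1 : q ≤ 1) (A : Set (ι → ZMod p)) :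
    (bernPi p q ι).real A = ∑ ω, (∏ i, bernWeight p q (ω i)) * A.indicator 1 ω := by
  classical
  have h := sum_measureReal_singleton (μ := bernPi p q ι) (Finset.univ.filter (· ∈ A))
  have hA : ((Finset.univ.filter (· ∈ A) : Finset (ι → ZMod p)) : Set (ι → ZMod p)) = A := by
    ext; simp
  rw [hA] at h
  rw [← h, Finset.sum_filter]
  refine Finset.sum_congr rfl fun ω _ => ?_
  rw [Measure.real, Measure.pi_singleton, ENNReal.toReal_prod]
  simp_rw [← measureReal_def, bern_real_singleton hq0 hq1, Set.indicator_apply]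
  simp

/-- Resampling the coordinates in the range of an injection does not change the law. -/
theorem sum_bernWeight_extend [Fact p.Prime] [DecidableEq ι] [DecidableEq κ]
    {e : κ → ι} (he : Function.Injective e) (f : (ι → ZMod p) → ℝ) :
    ∑ ω, (∏ i, bernWeight p q (ω i)) * f ω =
      ∑ ω, (∏ i, bernWeight p q (ω i)) *
        ∑ y : κ → ZMod p, (∏ j, bernWeight p q (y j)) * f (Function.extend e y ω) := by
  have hext : ∀ (ω : ι → ZMod p) (y : κ → ZMod p), Function.extend e y ω ∘ e = y :=
    fun ω y => funext fun j => he.extend_apply y ω j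
  have hback : ∀ (ω : ι → ZMod p) (y : κ → ZMod p),
      Function.extend e (ω ∘ e) (Function.extend e y ω) = ω := by
    intro ω y
    funext i
    by_cases hi : ∃ j, e j = i
    · obtain ⟨j, rfl⟩ := hi
      rw [he.extend_apply]; rfl
    · rw [Function.extend_apply' _ _ _ hi, Function.extend_apply' _ _ _ hi]
  let σ : (ι → ZMod p) × (κ → ZMod p) ≃ (ι → ZMod p) × (κ → ZMod p) :=
    { toFun := fun x => (Function.extend e x.2 x.1, x.1 ∘ e)
      invFun := fun x => (Function.extend e x.2 x.1, x.1 ∘ e)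
      left_inv := fun x => by simp only [hext, hback]
      right_inv := fun x => by simp only [hext, hback] }
  have hsplit : ∀ ω : ι → ZMod p, ∏ i, bernWeight p q (ω i) =
      (∏ j, bernWeight p q (ω (e j))) *
        ∏ i ∈ (Finset.univ.image e)ᶜ, bernWeight p q (ω i) := by
    intro ω
    rw [← Finset.prod_mul_prod_compl (Finset.univ.image e),
      Finset.prod_image fun _ _ _ _ h => he h]
  have hw : ∀ (ω : ι → ZMod p) (y : κ → ZMod p),
      (∏ i, bernWeight p q (Function.extend e y ω i)) * ∏ j, bernWeight p q (ω (e j)) =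
        (∏ i, bernWeight p q (ω i)) * ∏ j, bernWeight p q (y j) := by
    intro ω y
    rw [hsplit, hsplit ω]
    have h1 : ∏ i ∈ (Finset.univ.image e)ᶜ, bernWeight p q (Function.extend e y ω i) =
        ∏ i ∈ (Finset.univ.image e)ᶜ, bernWeight p q (ω i) := by
      refine Finset.prod_congr rfl fun i hi => ?_
      rw [Function.extend_apply']
      simpa using hi
    simp only [he.extend_apply, h1]
    ring
  calc ∑ ω, (∏ i, bernWeight p q (ω i)) * f ω
      = ∑ x : (ι → ZMod p) × (κ → ZMod p),
          (∏ i, bernWeight p q (x.1 i)) * (∏ j, bernWeight p q (x.2 j)) * f x.1 := by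
        rw [Fintype.sum_prod_type]
        refine Finset.sum_congr rfl fun ω _ => ?_
        simp only [mul_right_comm _ _ (f ω)]
        rw [← Finset.mul_sum, sum_prod_bernWeight, mul_one]
    _ = ∑ x : (ι → ZMod p) × (κ → ZMod p),
          (∏ i, bernWeight p q (x.1 i)) * (∏ j, bernWeight p q (x.2 j)) *
            f (Function.extend e x.2 x.1) := by
        refine (Fintype.sum_equiv σ _ _ fun x => ?_).symm
        simp only [σ, Equiv.coe_fn_mk, Function.comp_apply]
        rw [hw]
    _ = _ := by
        rw [Fintype.sum_prod_type]
        simp only [Finset.mul_sum, mul_assoc]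

/-! ### Fourier analysis -/

theorem exists_norm_bern_charFun_le [Fact p.Prime] (hq0 : 0 < q) (hq1 : q < 1) :
    ∃ ρ : ℝ, 0 < ρ ∧ ρ < 1 ∧ ∀ z : ZMod p, z ≠ 0 →
      ‖(q : ℂ) * ZMod.stdAddChar z + ((1 - q : ℝ) : ℂ)‖ ≤ ρ := by
  have h1 : ∀ z : ZMod p, z ≠ 0 → ‖(q : ℂ) * ZMod.stdAddChar z + ((1 - q : ℝ) : ℂ)‖ < 1 := by
    intro z hz
    have := norm_combo_lt_of_ne (E := ℂ) (x := ZMod.stdAddChar z) (y := 1) (a := q) (b := 1 - q)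
      (r := 1) (by rw [AddChar.norm_apply]) (by simp)
      (fun h => hz (ZMod.injective_stdAddChar (h.trans (AddChar.map_zero_eq_one _).symm)))
      hq0 (by linarith) (by ring)
    simpa [Complex.real_smul] using this
  obtain ⟨z₀, hz₀, hmax⟩ := Finset.exists_max_image (Finset.univ.filter fun z : ZMod p => z ≠ 0)
    (fun z => ‖(q : ℂ) * ZMod.stdAddChar z + ((1 - q : ℝ) : ℂ)‖) ⟨1, by simp⟩
  refine ⟨max (1 / 2) ‖(q : ℂ) * ZMod.stdAddChar z₀ + ((1 - q : ℝ) : ℂ)‖, by positivity,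
    max_lt (by norm_num) (h1 z₀ (by simpa using hz₀)), fun z hz => ?_⟩
  exact (hmax z (by simpa using hz)).trans (le_max_right _ _)

theorem bernPi_real_forall_eq_sum [Fact p.Prime] [DecidableEq ι] (hq0 : 0 ≤ q) (hq1 : q ≤ 1)
    {V : Type*} [AddCommGroup V] [Fintype V] [Module (ZMod p) V] (d : V →ₗ[ZMod p] ι → ZMod p) :
    (((bernPi p q ι).real {y | ∀ v, ∑ i, y i * d v i = 0} : ℝ) : ℂ) * Fintype.card V =
      ∑ v, ∏ i, ((q : ℂ) * ZMod.stdAddChar (d v i) + ((1 - q : ℝ) : ℂ)) := by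
  classical
  have hchar : ∀ y : ι → ZMod p,
      (((({y | ∀ v, ∑ i, y i * d v i = 0} : Set (ι → ZMod p)).indicator 1 y : ℝ)) : ℂ) *
        Fintype.card V = ∑ v, ∏ i, ZMod.stdAddChar (N := p) (y i * d v i) := by
    intro y
    let L : V →+ ZMod p :=
      { toFun := fun v => ∑ i, y i * d v i
        map_zero' := by simp
        map_add' := fun v w => by simp [mul_add, Finset.sum_add_distrib] }
    have h := AddChar.sum_eq_ite ((ZMod.stdAddChar (N := p)).compAddMonoidHom L)
    have hprod : ∀ v, ((ZMod.stdAddChar (N := p)).compAddMonoidHom L) v =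
        ∏ i, ZMod.stdAddChar (N := p) (y i * d v i) := by
      intro v
      change ZMod.stdAddChar (∑ i, y i * d v i) = _
      generalize (Finset.univ : Finset ι) = s
      induction s using Finset.induction_on with
      | empty => simp
      | insert i s hi ih => rw [Finset.sum_insert hi, Finset.prod_insert hi,
          AddChar.map_add_eq_mul, ih]
    simp only [hprod] at h
    rw [h]
    have hiff : (ZMod.stdAddChar (N := p)).compAddMonoidHom L = 0 ↔
        y ∈ ({y | ∀ v, ∑ i, y i * d v i = 0} : Set (ι → ZMod p)) := by
      constructor
      · intro h0 v
        have := DFunLike.congr_fun h0 v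
        exact ZMod.injective_stdAddChar (this.trans (AddChar.map_zero_eq_one _).symm)
      · intro h0
        ext v
        change ZMod.stdAddChar (∑ i, y i * d v i) = 1
        rw [h0 v, AddChar.map_zero_eq_one]
    simp only [hiff, Set.indicator_apply, Pi.one_apply]
    split_ifs <;> simp
  rw [bernPi_real_eq_sum hq0 hq1, Complex.ofReal_sum, Finset.sum_mul]
  simp only [Complex.ofReal_mul, mul_assoc, hchar, Finset.mul_sum]
  rw [Finset.sum_comm]
  refine Finset.sum_congr rfl fun v _ => ?_
  simp only [Complex.ofReal_prod, ← Finset.prod_mul_distrib]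
  have h := Finset.prod_univ_sum (fun _ : ι => (Finset.univ : Finset (ZMod p)))
    (fun i z => ((bernWeight p q z : ℝ) : ℂ) * ZMod.stdAddChar (z * d v i))
  rw [Fintype.piFinset_univ] at h
  rw [← h]
  refine Finset.prod_congr rfl fun i _ => ?_
  have := sum_bernWeight_mul (p := p) (q := q) (R := ℂ)
    (fun z => ZMod.stdAddChar (z * d v i))
  simpa using this

theorem abs_bernPi_real_forall_sub_le [Fact p.Prime] [DecidableEq ι] (hq0 : 0 ≤ q) (hq1 : q ≤ 1)
    {ρ : ℝ}
    (hρ : ∀ z : ZMod p, z ≠ 0 → ‖(q : ℂ) * ZMod.stdAddChar z + ((1 - q : ℝ) : ℂ)‖ ≤ ρ)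
    {V : Type*} [AddCommGroup V] [Fintype V] [Module (ZMod p) V] (d : V →ₗ[ZMod p] ι → ZMod p)
    {B : ℝ} (hB : ∀ v, d v ≠ 0 → ρ ^ hammingNorm (d v) ≤ B) :
    |(bernPi p q ι).real {y | ∀ v, ∑ i, y i * d v i = 0} -
        (Nat.card (LinearMap.ker d) : ℝ) / Fintype.card V| ≤
      B * (1 - (Nat.card (LinearMap.ker d) : ℝ) / Fintype.card V) := by
  classical
  have hF := bernPi_real_forall_eq_sum hq0 hq1 d
  set P := (bernPi p q ι).real {y | ∀ v, ∑ i, y i * d v i = 0}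
  have hV : (0 : ℝ) < Fintype.card V := by exact_mod_cast Fintype.card_pos
  set T := Finset.univ.filter fun v => d v = 0
  have hT : (Nat.card (LinearMap.ker d) : ℝ) = T.card := by
    rw [Nat.card_eq_fintype_card, Fintype.card_subtype]
    simp [T]
  have hTc : ((Tᶜ).card : ℝ) = Fintype.card V - T.card := by
    rw [Finset.card_compl, Nat.cast_sub (Finset.card_le_univ _)]
  rw [hT]
  rw [← Finset.sum_add_sum_compl T] at hF
  have h1 : ∑ v ∈ T, ∏ i, ((q : ℂ) * ZMod.stdAddChar (d v i) + ((1 - q : ℝ) : ℂ)) = T.card := by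
    rw [Finset.sum_congr rfl (g := fun _ => 1)]
    · simp
    · intro v hv
      have : d v = 0 := by simpa [T] using hv
      simp [this]
  rw [h1] at hF
  have h2 : ‖∑ v ∈ Tᶜ, ∏ i, ((q : ℂ) * ZMod.stdAddChar (d v i) + ((1 - q : ℝ) : ℂ))‖ ≤
      (Tᶜ).card * B := by
    rw [← nsmul_eq_mul]
    refine norm_sum_le_of_le _ (fun v hv => ?_) |>.trans (by rw [Finset.sum_const])
    have hv : d v ≠ 0 := by simpa [T] using hv
    refine le_trans ?_ (hB v hv)
    rw [norm_prod, hammingNorm, ← Finset.prod_const, Finset.prod_filter]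
    refine Finset.prod_le_prod (fun _ _ => norm_nonneg _) fun i _ => ?_
    split_ifs with hi
    · exact hρ _ hi
    · rw [not_not] at hi
      simp [hi]
  have h3 : ((P * Fintype.card V - T.card : ℝ) : ℂ) =
      ∑ v ∈ Tᶜ, ∏ i, ((q : ℂ) * ZMod.stdAddChar (d v i) + ((1 - q : ℝ) : ℂ)) := by
    rw [Complex.ofReal_sub, Complex.ofReal_mul, Complex.ofReal_natCast, Complex.ofReal_natCast, hF,
      add_sub_cancel_left]
  rw [← h3, Complex.norm_real, Real.norm_eq_abs, hTc] at h2
  have h4 : P - T.card / Fintype.card V = (P * Fintype.card V - T.card) / Fintype.card V := by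
    field_simp
  rw [h4, abs_div, abs_of_pos hV, div_le_iff₀ hV]
  refine h2.trans_eq ?_
  field_simp

theorem bernPi_real_dot_le [Fact p.Prime] [DecidableEq ι] (hq0 : 0 ≤ q) (hq1 : q ≤ 1)
    {ρ : ℝ}
    (hρ : ∀ z : ZMod p, z ≠ 0 → ‖(q : ℂ) * ZMod.stdAddChar z + ((1 - q : ℝ) : ℂ)‖ ≤ ρ)
    {b : ι → ZMod p} (hb : b ≠ 0) :
    (bernPi p q ι).real {y | ∑ i, y i * b i = 0} ≤
      1 / p + ρ ^ hammingNorm b * (1 - 1 / p) := by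
  let d : ZMod p →ₗ[ZMod p] ι → ZMod p := LinearMap.toSpanSingleton (ZMod p) _ b
  have hd : ∀ t i, d t i = t * b i := fun t i => by simp [d]
  have hker : LinearMap.ker d = ⊥ := by
    rw [LinearMap.ker_eq_bot']
    intro t ht
    have : t • b = 0 := ht
    exact (smul_eq_zero.mp this).resolve_right hb
  have h := abs_bernPi_real_forall_sub_le hq0 hq1 hρ d (B := ρ ^ hammingNorm b)
    (by
      intro t ht
      have ht0 : t ≠ 0 := by rintro rfl; simp at ht
      refine le_of_eq ?_
      congr 1
      exact hammingNorm_smul (fun _ => IsSMulRegular.of_ne_zero ht0) b)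
  have hset : {y : ι → ZMod p | ∀ t, ∑ i, y i * d t i = 0} = {y | ∑ i, y i * b i = 0} := by
    ext y
    constructor
    · intro h; simpa [hd] using h 1
    · intro h t
      have h : ∑ i, y i * b i = 0 := h
      simp only [hd, mul_left_comm _ t, ← Finset.mul_sum, h, mul_zero]
  rw [hset, hker, ZMod.card] at h
  simp only [Nat.card_unique, Nat.cast_one] at h
  linarith [(abs_le.mp h).2]

end BernPi

section Rows

variable {p : ℕ} {q : ℝ} {ι κ : Type} [Fintype ι] [Fintype κ]

theorem bernPi_real_pi [Fact p.Prime] [DecidableEq ι] [DecidableEq κ] (hq0 : 0 ≤ q) (hq1 : q ≤ 1) (f : ι → Set (κ → ZMod p)) :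
    ∏ i, (bernPi p q κ).real (f i) =
      ∑ x : ι → κ → ZMod p, ∏ i, (∏ j, bernWeight p q (x i j)) * (f i).indicator 1 (x i) := by
  simp only [bernPi_real_eq_sum hq0 hq1]
  have h := Finset.prod_univ_sum (fun _ : ι => (Finset.univ : Finset (κ → ZMod p)))
    (fun i x => (∏ j, bernWeight p q (x j)) * (f i).indicator 1 x)
  rwa [Fintype.piFinset_univ] at h

/-- The rows of the edge indicators of a directed bipartite graph are independent. -/
theorem bernPi_real_rows [Fact p.Prime] [DecidableEq ι] [DecidableEq κ] (hq0 : 0 ≤ q) (hq1 : q ≤ 1)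
    (f : ι → Set (κ → ZMod p)) (g : κ → Set (ι → ZMod p)) :
    (bernPi p q (ι × κ ⊕ κ × ι)).real
        {ω | (∀ i, (fun j => ω (.inl (i, j))) ∈ f i) ∧ ∀ j, (fun i => ω (.inr (j, i))) ∈ g j} =
      (∏ i, (bernPi p q κ).real (f i)) * ∏ j, (bernPi p q ι).real (g j) := by
  classical
  rw [bernPi_real_pi hq0 hq1, bernPi_real_pi hq0 hq1, Finset.sum_mul_sum, ← Finset.sum_product',
    Finset.univ_product_univ, bernPi_real_eq_sum hq0 hq1]
  let σ : (ι × κ ⊕ κ × ι → ZMod p) ≃ (ι → κ → ZMod p) × (κ → ι → ZMod p) :=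
    (Equiv.sumArrowEquivProdArrow _ _ _).trans
      ((Equiv.curry _ _ _).prodCongr (Equiv.curry _ _ _))
  refine Fintype.sum_equiv σ _ _ fun ω => ?_
  have h1 : ∀ i j, (σ ω).1 i j = ω (.inl (i, j)) := fun _ _ => rfl
  have h2 : ∀ i j, (σ ω).2 i j = ω (.inr (i, j)) := fun _ _ => rfl
  have h1' : ∀ i, (σ ω).1 i = fun j => ω (.inl (i, j)) := fun _ => rfl
  have h2' : ∀ i, (σ ω).2 i = fun j => ω (.inr (i, j)) := fun _ => rfl
  rw [Finset.prod_mul_distrib, Finset.prod_mul_distrib, mul_mul_mul_comm]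
  congr 1
  · rw [Fintype.prod_sum_type, Fintype.prod_prod_type, Fintype.prod_prod_type]
    rfl
  · simp only [Set.indicator_apply, Set.mem_ofPred_eq, Pi.one_apply, Finset.prod_boole,
      Finset.mem_univ, true_imp_iff, h1', h2', ← ite_and, mul_ite, mul_one, mul_zero]
    by_cases ha : ∀ i, (fun j => ω (.inl (i, j))) ∈ f i <;>
    by_cases hb : ∀ i, (fun j => ω (.inr (i, j))) ∈ g i <;> simp [ha, hb]

/-- The generating function of the Hamming weight. -/
theorem sum_pow_hammingNorm [Fact p.Prime] [DecidableEq ι] (z : ℝ) :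
    ∑ u : ι → ZMod p, z ^ hammingNorm u = (1 + (p - 1) * z) ^ Fintype.card ι := by
  have h := Finset.prod_univ_sum (fun _ : ι => (Finset.univ : Finset (ZMod p)))
    (fun _ x => if x ≠ 0 then z else 1)
  rw [Fintype.piFinset_univ] at h
  have h1 : ∀ u : ι → ZMod p, z ^ hammingNorm u = ∏ i, if u i ≠ 0 then z else 1 := by
    intro u
    rw [hammingNorm, ← Finset.prod_const, Finset.prod_filter]
  simp only [h1]
  rw [← h, Finset.prod_const, Finset.card_univ]
  congr 1
  rw [← Finset.add_sum_erase _ _ (Finset.mem_univ 0),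
    Finset.sum_congr rfl (g := fun _ => z) (fun x hx => by simp [Finset.ne_of_mem_erase hx])]
  simp [Finset.card_erase_of_mem, ZMod.card, Nat.cast_sub (Fact.out : p.Prime).one_le]

theorem prod_le_pow_card_filter {f : ι → ℝ} {x : ℝ} (P : ι → Prop) [DecidablePred P]
    (h0 : ∀ i, 0 ≤ f i) (h1 : ∀ i, f i ≤ 1) (hx : ∀ i, P i → f i ≤ x) :
    ∏ i, f i ≤ x ^ (Finset.univ.filter P).card := by
  rw [← Finset.prod_const, Finset.prod_filter]
  refine Finset.prod_le_prod (fun i _ => h0 i) fun i _ => ?_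
  split_ifs with h
  · exact hx i h
  · exact h1 i

theorem card_filter_eq_zero_add_hammingNorm (u : ι → ZMod p) :
    (Finset.univ.filter fun i => u i = 0).card + hammingNorm u = Fintype.card ι := by
  rw [hammingNorm, Finset.card_filter_add_card_filter_not, Finset.card_univ]

theorem card_le_hammingNorm_sub_add (u : ι → ZMod p) {c : ZMod p} (hc : c ≠ 0) :
    Fintype.card ι ≤ hammingNorm (fun i => u i - c) + hammingNorm u := by
  rw [← card_filter_eq_zero_add_hammingNorm u]
  refine Nat.add_le_add_right (Finset.card_le_card fun i hi => ?_) _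
  have : u i = 0 := by simpa using hi
  simp [this, hc]

end Rows

theorem card_filter_lt_sub {a k : ℕ} :
    (Finset.univ.filter fun j : Fin a => (j : ℕ) < a - k).card = a - k := by
  rw [Fin.card_filter_val_lt]
  omega

theorem hammingNorm_le_card_filter_lt_add {p a k : ℕ} (w : Fin a → ZMod p) :
    hammingNorm w ≤
      (Finset.univ.filter fun j : Fin a => (j : ℕ) < a - k ∧ w j ≠ 0).card + k := by
  have h1 : hammingNorm w ≤
      (Finset.univ.filter fun j : Fin a => (j : ℕ) < a - k ∧ w j ≠ 0).card +
        (Finset.univ.filter fun j : Fin a => ¬ (j : ℕ) < a - k).card := by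
    rw [hammingNorm]
    refine (Finset.card_le_card fun j hj => ?_).trans (Finset.card_union_le _ _)
    simp only [Finset.mem_filter, Finset.mem_univ, true_and, Finset.mem_union] at hj ⊢
    tauto
  have h2 := Finset.card_filter_add_card_filter_not (s := (Finset.univ : Finset (Fin a)))
    (fun j : Fin a => (j : ℕ) < a - k)
  rw [card_filter_lt_sub, Finset.card_univ, Fintype.card_fin] at h2
  omega

/-- The event that the vector with coordinates `u` on the first part and `w` on the second is
orthogonal to all rows of the Laplacian but the last `k`. -/
def orthEvent {p n a : ℕ} (k : ℕ) (u : Fin n → ZMod p) (w : Fin a → ZMod p) :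
    Set (LapIdx n a → ZMod p) :=
  {ω | (∀ i, ∑ j, ω (.inl (i, j)) * (w j - u i) = 0) ∧
    ∀ j : Fin a, (j : ℕ) < a - k → ∑ i, ω (.inr (j, i)) * (u i - w j) = 0}

theorem lapMeasure_real_orthEvent {p n a k : ℕ} {q : ℝ} [Fact p.Prime] (hq0 : 0 ≤ q) (hq1 : q ≤ 1)
    (u : Fin n → ZMod p) (w : Fin a → ZMod p) :
    (lapMeasure p n a q).real (orthEvent k u w) =
      (∏ i, (bernPi p q (Fin a)).real {x | ∑ j, x j * (w j - u i) = 0}) *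
        ∏ j : Fin a, (bernPi p q (Fin n)).real
          {y | (j : ℕ) < a - k → ∑ i, y i * (u i - w j) = 0} := by
  rw [← bernPi_real_rows hq0 hq1]
  rfl

theorem lapMeasure_real_orthEvent_le {p n a k : ℕ} {q : ℝ} [Fact p.Prime]
    (hq0 : 0 ≤ q) (hq1 : q ≤ 1) {ρ A D Z η : ℝ} (hρ0 : 0 ≤ ρ) (hρ1 : ρ ≤ 1)
    (hρ : ∀ z : ZMod p, z ≠ 0 → ‖(q : ℂ) * ZMod.stdAddChar z + ((1 - q : ℝ) : ℂ)‖ ≤ ρ)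
    (hA : 0 < A) (hρA : 1 / p + ρ * (1 - 1 / p) ≤ Real.exp (-A))
    (hD : 0 < D) (hZ : 0 < Z) (hη : η ≤ 1 / 2)
    (hρD : ∀ m : ℕ, η * n ≤ m → 1 / p + ρ ^ m ≤ Real.exp (-D)) (hk : k ≤ a)
    (u : Fin n → ZMod p) (w : Fin a → ZMod p) (hu : (hammingNorm u : ℝ) ≤ η * n)
    (huw : w = 0 → u ≠ 0) :
    (lapMeasure p n a q).real (orthEvent k u w) ≤
      Real.exp (Z * η * n) * Real.exp (-Z) ^ hammingNorm u *
        (Real.exp (-A * (a - k)) * (if w = 0 then 1 else 0) +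
          Real.exp (-A * ((1 - η) * n)) * Real.exp (Z * η * n) * Real.exp (-Z) ^ hammingNorm w +
          Real.exp (-D * ((1 - η) * n - k)) * Real.exp (-D) ^ hammingNorm w) := by
  have := bern_isProbabilityMeasure (p := p) hq0 hq1
  have hp2 : (2 : ℝ) ≤ p := by exact_mod_cast (Fact.out : p.Prime).two_le
  have hp1 : (1 : ℝ) / p ≤ 1 := by
    rw [div_le_one (by linarith)]; linarith
  have hp0 : (0 : ℝ) ≤ 1 / p := by positivity
  have hsmall : ∀ {m : ℕ} (b : Fin m → ZMod p), b ≠ 0 →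
      (bernPi p q (Fin m)).real {y | ∑ i, y i * b i = 0} ≤ Real.exp (-A) := by
    intro m b hb
    refine (bernPi_real_dot_le hq0 hq1 hρ hb).trans (le_trans ?_ hρA)
    have : ρ ^ hammingNorm b ≤ ρ :=
      pow_le_of_le_one hρ0 hρ1 (by simpa [hammingNorm_eq_zero] using hb)
    gcongr
  have hlarge : ∀ {m : ℕ} (b : Fin m → ZMod p), b ≠ 0 → η * n ≤ hammingNorm b →
      (bernPi p q (Fin m)).real {y | ∑ i, y i * b i = 0} ≤ Real.exp (-D) := by
    intro m b hb hbn
    refine (bernPi_real_dot_le hq0 hq1 hρ hb).trans (le_trans ?_ (hρD _ hbn))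
    have : 0 ≤ ρ ^ hammingNorm b := by positivity
    nlinarith
  have hfirst : 1 ≤ Real.exp (Z * η * n) * Real.exp (-Z) ^ hammingNorm u := by
    rw [← Real.exp_nat_mul, ← Real.exp_add, Real.one_le_exp_iff]
    nlinarith
  refine le_trans ?_ (le_mul_of_one_le_left (by positivity) hfirst)
  rw [lapMeasure_real_orthEvent hq0 hq1]
  have hcard : ((Finset.univ.filter fun i => u i = 0).card : ℝ) ≥ (1 - η) * n := by
    have h := card_filter_eq_zero_add_hammingNorm u
    rw [Fintype.card_fin] at h
    have : ((Finset.univ.filter fun i => u i = 0).card : ℝ) + hammingNorm u = n := by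
      exact_mod_cast h
    linarith
  have hpow : ∀ {B : ℝ} {t : ℝ} {m : ℕ}, 0 < B → t ≤ m → Real.exp (-B) ^ m ≤ Real.exp (-B * t) := by
    intro B t m hB ht
    rw [← Real.exp_nat_mul, Real.exp_le_exp]
    nlinarith
  have hterm2 : 0 ≤ Real.exp (-A * ((1 - η) * n)) * Real.exp (Z * η * n) *
      Real.exp (-Z) ^ hammingNorm w := by positivity
  have hterm3 : 0 ≤ Real.exp (-D * ((1 - η) * n - k)) * Real.exp (-D) ^ hammingNorm w := by
    positivity
  by_cases hw : w = 0
  · have h1 : ∏ i, (bernPi p q (Fin a)).real {x | ∑ j, x j * (w j - u i) = 0} ≤ 1 :=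
      Finset.prod_le_one (fun _ _ => measureReal_nonneg) fun _ _ => measureReal_le_one
    have h2 : ∏ j : Fin a, (bernPi p q (Fin n)).real
        {y | (j : ℕ) < a - k → ∑ i, y i * (u i - w j) = 0} ≤ Real.exp (-A * (a - k)) := by
      refine (prod_le_pow_card_filter (x := Real.exp (-A)) (fun j : Fin a => (j : ℕ) < a - k)
        (fun _ => measureReal_nonneg) (fun _ => measureReal_le_one) fun j hj => ?_).trans ?_
      · simp only [hj, true_imp_iff, hw, Pi.zero_apply, sub_zero]
        exact hsmall u (huw hw)
      · rw [card_filter_lt_sub]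
        exact hpow hA (by rw [Nat.cast_sub hk])
    have := mul_le_mul h1 h2 (Finset.prod_nonneg fun _ _ => measureReal_nonneg) zero_le_one
    rw [one_mul] at this
    simp only [hw, if_true, mul_one] at hterm2 hterm3 this ⊢
    linarith
  have hw0 : ∀ i, u i = 0 → (fun j => w j - u i) = w := by
    intro i hi
    funext j
    rw [hi, sub_zero]
  simp only [hw, if_false, mul_zero, zero_add]
  by_cases hwn : (hammingNorm w : ℝ) ≤ η * n
  · have h1 : ∏ i, (bernPi p q (Fin a)).real {x | ∑ j, x j * (w j - u i) = 0} ≤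
        Real.exp (-A * ((1 - η) * n)) := by
      refine (prod_le_pow_card_filter (x := Real.exp (-A)) (fun i => u i = 0)
        (fun _ => measureReal_nonneg) (fun _ => measureReal_le_one) fun i hi => ?_).trans
        (hpow hA hcard)
      exact hsmall _ (by rwa [hw0 i hi])
    have h2 : ∏ j : Fin a, (bernPi p q (Fin n)).real
        {y | (j : ℕ) < a - k → ∑ i, y i * (u i - w j) = 0} ≤ 1 :=
      Finset.prod_le_one (fun _ _ => measureReal_nonneg) fun _ _ => measureReal_le_one
    have h3 : 1 ≤ Real.exp (Z * η * n) * Real.exp (-Z) ^ hammingNorm w := by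
      rw [← Real.exp_nat_mul, ← Real.exp_add, Real.one_le_exp_iff]
      nlinarith
    have h4 := mul_le_mul h1 (h2.trans h3) (Finset.prod_nonneg fun _ _ => measureReal_nonneg)
      (Real.exp_pos _).le
    rw [← mul_assoc] at h4
    linarith
  · have h1 : ∏ i, (bernPi p q (Fin a)).real {x | ∑ j, x j * (w j - u i) = 0} ≤
        Real.exp (-D * ((1 - η) * n)) := by
      refine (prod_le_pow_card_filter (x := Real.exp (-D)) (fun i => u i = 0)
        (fun _ => measureReal_nonneg) (fun _ => measureReal_le_one) fun i hi => ?_).trans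
        (hpow hD hcard)
      exact hlarge _ (by rwa [hw0 i hi]) (by rw [hw0 i hi]; exact (not_le.mp hwn).le)
    have h2 : ∏ j : Fin a, (bernPi p q (Fin n)).real
        {y | (j : ℕ) < a - k → ∑ i, y i * (u i - w j) = 0} ≤
        Real.exp (-D * (hammingNorm w - k)) := by
      refine (prod_le_pow_card_filter (x := Real.exp (-D))
        (fun j : Fin a => (j : ℕ) < a - k ∧ w j ≠ 0)
        (fun _ => measureReal_nonneg) (fun _ => measureReal_le_one) fun j hj => ?_).trans
        (hpow hD ?_)
      · simp only [hj.1, true_imp_iff]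
        have hcard' := card_le_hammingNorm_sub_add u hj.2
        rw [Fintype.card_fin] at hcard'
        have hcard'' : (n : ℝ) ≤ hammingNorm (fun i => u i - w j) + hammingNorm u := by
          exact_mod_cast hcard'
        have hn : (0 : ℝ) ≤ n := n.cast_nonneg
        by_cases hb : (fun i => u i - w j) = 0
        · have hn0 : n = 0 := by
            rw [hb, hammingNorm_zero] at hcard''
            have : (n : ℝ) ≤ 0 := by push_cast at hcard''; nlinarith
            exact_mod_cast le_antisymm this hn
          have hbig : (1 : ℝ) ≤ Real.exp (-D) := by
            have := hρD 0 (by simp [hn0])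
            rw [pow_zero] at this
            linarith
          exact measureReal_le_one.trans hbig
        · refine hlarge _ hb ?_
          nlinarith
      · have := hammingNorm_le_card_filter_lt_add (k := k) w
        have : (hammingNorm w : ℝ) ≤
            (Finset.univ.filter fun j : Fin a => (j : ℕ) < a - k ∧ w j ≠ 0).card + k := by
          exact_mod_cast this
        linarith
    have h4 := mul_le_mul h1 h2 (Finset.prod_nonneg fun _ _ => measureReal_nonneg)
      (Real.exp_pos _).le
    have h5 : Real.exp (-D * ((1 - η) * n)) * Real.exp (-D * (hammingNorm w - k)) =
        Real.exp (-D * ((1 - η) * n - k)) * Real.exp (-D) ^ hammingNorm w := by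
      rw [← Real.exp_nat_mul, ← Real.exp_add, ← Real.exp_add]
      ring_nf
    linarith

theorem sum_lapMeasure_real_orthEvent_le {p n a k : ℕ} {q : ℝ} [Fact p.Prime]
    (hq0 : 0 ≤ q) (hq1 : q ≤ 1) {ρ A D Z η : ℝ} (hρ0 : 0 ≤ ρ) (hρ1 : ρ ≤ 1)
    (hρ : ∀ z : ZMod p, z ≠ 0 → ‖(q : ℂ) * ZMod.stdAddChar z + ((1 - q : ℝ) : ℂ)‖ ≤ ρ)
    (hA : 0 < A) (hρA : 1 / p + ρ * (1 - 1 / p) ≤ Real.exp (-A))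
    (hD : 0 < D) (hZ : 0 < Z) (hη : η ≤ 1 / 2)
    (hρD : ∀ m : ℕ, η * n ≤ m → 1 / p + ρ ^ m ≤ Real.exp (-D)) (hk : k ≤ a) :
    (lapMeasure p n a q).real {ω | ∃ (u : Fin n → ZMod p) (w : Fin a → ZMod p),
        (hammingNorm u : ℝ) ≤ η * n ∧ (w = 0 → u ≠ 0) ∧ ω ∈ orthEvent k u w} ≤
      Real.exp (Z * η * n) * (1 + (p - 1) * Real.exp (-Z)) ^ n *
        (Real.exp (-A * (a - k)) +
          Real.exp (-A * ((1 - η) * n)) * Real.exp (Z * η * n) *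
            (1 + (p - 1) * Real.exp (-Z)) ^ a +
          Real.exp (-D * ((1 - η) * n - k)) * (1 + (p - 1) * Real.exp (-D)) ^ a) := by
  classical
  set T : Finset ((Fin n → ZMod p) × (Fin a → ZMod p)) :=
    Finset.univ.filter fun x => (hammingNorm x.1 : ℝ) ≤ η * n ∧ (x.2 = 0 → x.1 ≠ 0)
  have hset : {ω : LapIdx n a → ZMod p | ∃ (u : Fin n → ZMod p) (w : Fin a → ZMod p),
      (hammingNorm u : ℝ) ≤ η * n ∧ (w = 0 → u ≠ 0) ∧ ω ∈ orthEvent k u w} =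
      ⋃ x ∈ T, orthEvent k x.1 x.2 := by
    ext ω
    simp only [T, Set.mem_ofPred_eq, Set.mem_iUnion, Finset.mem_filter, Finset.mem_univ, true_and,
      Prod.exists, exists_prop, and_assoc]
  rw [hset]
  refine (measureReal_biUnion_finset_le _ _).trans ?_
  let F : (Fin n → ZMod p) × (Fin a → ZMod p) → ℝ := fun x =>
    Real.exp (Z * η * n) * Real.exp (-Z) ^ hammingNorm x.1 *
      (Real.exp (-A * (a - k)) * (if x.2 = 0 then 1 else 0) +
        Real.exp (-A * ((1 - η) * n)) * Real.exp (Z * η * n) * Real.exp (-Z) ^ hammingNorm x.2 +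
        Real.exp (-D * ((1 - η) * n - k)) * Real.exp (-D) ^ hammingNorm x.2)
  refine (Finset.sum_le_sum (g := F) fun x hx => ?_).trans
    ((Finset.sum_le_sum_of_subset_of_nonneg (Finset.subset_univ T) ?_).trans (le_of_eq ?_))
  · have hx' := (Finset.mem_filter.mp hx).2
    exact lapMeasure_real_orthEvent_le hq0 hq1 hρ0 hρ1 hρ hA hρA hD hZ hη hρD hk _ _ hx'.1 hx'.2
  · intro x _ _
    simp only [F]
    positivity
  · simp only [F, Fintype.sum_prod_type, ← Finset.mul_sum, Finset.sum_add_distrib, sum_pow_hammingNorm,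
      Finset.sum_ite_eq', Finset.mem_univ, if_true, mul_one, Fintype.card_fin, ← Finset.sum_mul]

/-- If `F` does not depend on the coordinates in the range of `e`, and `G` has probability close to
`s` after resampling these coordinates from any point of `F`, then the conditional probability of
`G` given `F` is close to `s`. -/
theorem abs_bernPi_real_inter_sub_le {p : ℕ} [Fact p.Prime] {q : ℝ} (hq0 : 0 ≤ q) (hq1 : q ≤ 1)
    {ι κ : Type} [Fintype ι] [Fintype κ] [DecidableEq ι] [DecidableEq κ]
    {e : κ → ι} (he : Function.Injective e) {F G : Set (ι → ZMod p)}
    (hF : ∀ ω y, Function.extend e y ω ∈ F ↔ ω ∈ F) {s B : ℝ}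
    (h : ∀ ω ∈ F, |(bernPi p q κ).real {y | Function.extend e y ω ∈ G} - s| ≤ B) :
    |(bernPi p q ι).real (F ∩ G) - s * (bernPi p q ι).real F| ≤ B * (bernPi p q ι).real F := by
  classical
  have hinner : ∀ ω : ι → ZMod p, ∑ y : κ → ZMod p, (∏ j, bernWeight p q (y j)) *
      (F ∩ G).indicator 1 (Function.extend e y ω) =
      F.indicator 1 ω * (bernPi p q κ).real {y | Function.extend e y ω ∈ G} := by
    intro ω
    rw [bernPi_real_eq_sum hq0 hq1, Finset.mul_sum]
    refine Finset.sum_congr rfl fun y _ => ?_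
    simp only [Set.indicator_apply, Set.mem_inter_iff, hF, Set.mem_ofPred_eq, Pi.one_apply]
    by_cases h1 : ω ∈ F <;> simp [h1]
  rw [bernPi_real_eq_sum hq0 hq1 (F ∩ G), sum_bernWeight_extend he, bernPi_real_eq_sum hq0 hq1 F,
    Finset.mul_sum, Finset.mul_sum, ← Finset.sum_sub_distrib]
  refine (Finset.abs_sum_le_sum_abs _ _).trans (Finset.sum_le_sum fun ω _ => ?_)
  rw [hinner]
  have hw : 0 ≤ ∏ i, bernWeight p q (ω i) :=
    Finset.prod_nonneg fun _ _ => bernWeight_nonneg hq0 hq1 _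
  by_cases h1 : ω ∈ F
  · simp only [Set.indicator_of_mem h1, Pi.one_apply, one_mul, mul_one]
    rw [mul_comm s, ← mul_sub, abs_mul, abs_of_nonneg hw, mul_comm]
    exact mul_le_mul_of_nonneg_right (h ω h1) hw
  · simp [h1]

/-! ### Rows of the Laplacian -/

section Laplacian

variable {p n a : ℕ}

theorem sum_lapM_castAdd (ω : LapIdx n a → ZMod p) (i : Fin n) (v : Fin (n + a) → ZMod p) :
    ∑ c, lapM p n a ω (Fin.castAdd a i) c * v c =
      ∑ j, ω (.inl (i, j)) * (v (Fin.natAdd n j) - v (Fin.castAdd a i)) := by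
  rw [Fin.sum_univ_add]
  have h1 : ∀ i' : Fin n, lapM p n a ω (Fin.castAdd a i) (Fin.castAdd a i') =
      if i = i' then -∑ j, ω (.inl (i, j)) else 0 := by
    intro i'
    simp [lapM, Fin.ext_iff]
  have h2 : ∀ j : Fin a, lapM p n a ω (Fin.castAdd a i) (Fin.natAdd n j) = ω (.inl (i, j)) := by
    intro j
    simp [lapM]
  simp only [h1, h2, ite_mul, zero_mul, Finset.sum_ite_eq, Finset.mem_univ, if_true, mul_sub,
    Finset.sum_sub_distrib, ← Finset.sum_mul]
  ring

theorem sum_lapM_natAdd (ω : LapIdx n a → ZMod p) (j : Fin a) (v : Fin (n + a) → ZMod p) :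
    ∑ c, lapM p n a ω (Fin.natAdd n j) c * v c =
      ∑ i, ω (.inr (j, i)) * (v (Fin.castAdd a i) - v (Fin.natAdd n j)) := by
  rw [Fin.sum_univ_add]
  have h1 : ∀ j' : Fin a, lapM p n a ω (Fin.natAdd n j) (Fin.natAdd n j') =
      if j = j' then -∑ i, ω (.inr (j, i)) else 0 := by
    intro i'
    simp [lapM, Fin.ext_iff]
  have h2 : ∀ i : Fin n, lapM p n a ω (Fin.natAdd n j) (Fin.castAdd a i) = ω (.inr (j, i)) := by
    intro j
    simp [lapM]
  simp only [h1, h2, ite_mul, zero_mul, Finset.sum_ite_eq, Finset.mem_univ, if_true, mul_sub,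
    Finset.sum_sub_distrib, ← Finset.sum_mul]
  ring

theorem mem_ker_firstRows_iff {k : ℕ} (hk : k ≤ a) (ω : LapIdx n a → ZMod p)
    (v : Fin (n + a) → ZMod p) :
    v ∈ LinearMap.ker (firstRows p n a (n + a - k) (Nat.sub_le _ _) ω).mulVecLin ↔
      ω ∈ orthEvent k (fun i => v (Fin.castAdd a i)) (fun j => v (Fin.natAdd n j)) := by
  simp only [orthEvent, Set.mem_ofPred_eq, ← sum_lapM_castAdd, ← sum_lapM_natAdd]
  rw [LinearMap.mem_ker, Matrix.mulVecLin_apply, funext_iff]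
  constructor
  · intro h
    exact ⟨fun i => h ⟨i, by omega⟩, fun j hj => h ⟨n + j, by omega⟩⟩
  · rintro ⟨h1, h2⟩ r
    by_cases hr : (r : ℕ) < n
    · exact h1 ⟨r, hr⟩
    · have h := h2 ⟨r - n, by omega⟩ (by simp only; omega)
      have hrow : Fin.natAdd n ⟨r - n, by omega⟩ = Fin.castLE (Nat.sub_le (n + a) k) r := by
        ext; simp only [Fin.val_natAdd, Fin.val_castLE]; omega
      rw [hrow] at h
      exact h

theorem lapM_extend {j : Fin a} {e : Fin n → LapIdx n a} (he : ∀ i, e i = .inr (j, i))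
    (ω : LapIdx n a → ZMod p) (y : Fin n → ZMod p) {r : Fin (n + a)} (hr : (r : ℕ) ≠ n + j) :
    lapM p n a (Function.extend e y ω) r = lapM p n a ω r := by
  have h1 : ∀ x, Function.extend e y ω (.inl x) = ω (.inl x) := by
    intro x
    rw [Function.extend_apply']
    simp [he]
  have h2 : ∀ j' i, j' ≠ j → Function.extend e y ω (.inr (j', i)) = ω (.inr (j', i)) := by
    intro j' i hj
    rw [Function.extend_apply']
    rintro ⟨i', hi'⟩
    rw [he] at hi'
    simp only [Sum.inr.injEq, Prod.mk.injEq] at hi'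
    exact hj hi'.1.symm
  funext c
  simp only [lapM, h1]
  by_cases hrn : (r : ℕ) < n
  · simp only [hrn, dif_pos]
  · have hj : ∀ h : (r : ℕ) - n < a, (⟨(r : ℕ) - n, h⟩ : Fin a) ≠ j := by
      intro h hj
      apply hr
      rw [← hj]
      simp only
      omega
    simp only [hrn, dif_neg, not_false_eq_true, h2 _ _ (hj _)]

theorem mem_span_range_iff_forall_ker {K m N : Type*} [Field K] [Fintype N] [DecidableEq N]
    [Finite m] (A : Matrix m N K) (x : N → K) :
    x ∈ Submodule.span K (Set.range A) ↔
      ∀ v ∈ LinearMap.ker A.mulVecLin, ∑ c, x c * v c = 0 := by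
  constructor
  · intro hx v hv
    refine Submodule.span_induction (p := fun x _ => ∑ c, x c * v c = 0) ?_ ?_ ?_ ?_ hx
    · rintro _ ⟨r, rfl⟩
      exact congrFun (LinearMap.mem_ker.mp hv) r
    · simp
    · intro x y _ _ hx hy
      simp [add_mul, Finset.sum_add_distrib, hx, hy]
    · intro t x _ hx
      simp [mul_assoc, ← Finset.mul_sum, hx]
  · intro h
    by_contra hx
    obtain ⟨f, hfx, hf⟩ := Submodule.exists_le_ker_of_notMem hx
    have hsum : ∀ z : N → K, ∑ c, z c * f (Pi.single c 1) = f z := by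
      intro z
      conv_rhs => rw [pi_eq_sum_univ' z, map_sum]
      simp [map_smul]
    refine hfx ?_
    rw [← hsum]
    refine h _ ?_
    rw [LinearMap.mem_ker]
    funext r
    exact (hsum (A r)).trans (hf (Submodule.subset_span ⟨r, rfl⟩))

theorem finrank_ker_mulVecLin_eq {K m : Type*} {N : ℕ} [Field K] [Finite m]
    (A : Matrix m (Fin N) K) :
    Module.finrank K (LinearMap.ker A.mulVecLin) =
      N - Module.finrank K (Submodule.span K (Set.range A)) := by
  have h1 := LinearMap.finrank_range_add_finrank_ker A.mulVecLin
  have h2 : Module.finrank K (LinearMap.range A.mulVecLin) =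
      Module.finrank K (Submodule.span K (Set.range A)) := A.rank_eq_finrank_span_row
  rw [Module.finrank_fin_fun] at h1
  omega

/-- The conditional probability that the next row lies in the span of the first rows. -/
theorem abs_bernPi_real_mem_rowSpan_sub_le [Fact p.Prime] {q : ℝ} (hq0 : 0 ≤ q) (hq1 : q ≤ 1)
    {ρ : ℝ} (hρ0 : 0 < ρ) (hρ1 : ρ < 1)
    (hρ : ∀ z : ZMod p, z ≠ 0 → ‖(q : ℂ) * ZMod.stdAddChar z + ((1 - q : ℝ) : ℂ)‖ ≤ ρ)
    {k : ℕ} (hk1 : 1 ≤ k) (hk : k ≤ a) {t : ℝ} (ht : 0 ≤ t) {ω : LapIdx n a → ZMod p}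
    (hω : ∀ v ∈ LinearMap.ker (firstRows p n a (n + a - k) (Nat.sub_le _ _) ω).mulVecLin, v ≠ 0 →
      t < hammingNorm fun i => v (Fin.castAdd a i))
    {e : Fin n → LapIdx n a} (he : ∀ i, e i = .inr (⟨a - k, by omega⟩, i)) {l : ℕ} (hl : 1 ≤ l)
    (hcodim : (n + a) - Module.finrank (ZMod p)
      (rowSpan p n a (n + a - k) (Nat.sub_le _ _) ω) = l) :
    |(bernPi p q (Fin n)).real {y | lapM p n a (Function.extend e y ω) ⟨n + a - k, by omega⟩ ∈
        rowSpan p n a (n + a - k) (Nat.sub_le _ _) ω} - (1 / (p : ℝ)) ^ (l - 1)| ≤ ρ ^ t := by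
  classical
  set A := firstRows p n a (n + a - k) (Nat.sub_le _ _) ω
  set V := LinearMap.ker A.mulVecLin
  let j₀ : Fin a := ⟨a - k, by omega⟩
  have he_inj : Function.Injective e := by
    intro i i' h
    rw [he, he] at h
    simpa using h
  have hconst : ∀ c : ZMod p, (fun _ => c) ∈ V := by
    intro c
    rw [mem_ker_firstRows_iff hk]
    simp [orthEvent]
  let d : V →ₗ[ZMod p] Fin n → ZMod p :=
    { toFun := fun v i => v.1 (Fin.castAdd a i) - v.1 (Fin.natAdd n j₀)
      map_add' := fun v w => by
        funext i
        simp only [Submodule.coe_add, Pi.add_apply]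
        ring
      map_smul' := fun c v => by
        funext i
        simp [mul_sub] }
  have hshift : ∀ v : V, d v = fun i =>
      (v.1 - (fun _ => v.1 (Fin.natAdd n j₀)) : Fin (n + a) → ZMod p) (Fin.castAdd a i) :=
    fun _ => rfl
  have hset : {y : Fin n → ZMod p | lapM p n a (Function.extend e y ω) ⟨n + a - k, by omega⟩ ∈
      rowSpan p n a (n + a - k) (Nat.sub_le _ _) ω} = {y | ∀ v, ∑ i, y i * d v i = 0} := by
    ext y
    rw [Set.mem_ofPred_eq, Set.mem_ofPred_eq, rowSpan, mem_span_range_iff_forall_ker]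
    have hrow : (⟨n + a - k, by omega⟩ : Fin (n + a)) = Fin.natAdd n j₀ := by
      ext
      simp only [Fin.val_natAdd, j₀]
      omega
    have hy : ∀ i, Function.extend e y ω (.inr (j₀, i)) = y i := fun i => by
      rw [← he i, he_inj.extend_apply]
    simp only [hrow, sum_lapM_natAdd, hy]
    exact ⟨fun h v => h v.1 v.2, fun h v hv => h ⟨v, hv⟩⟩
  have hcardV : (Fintype.card V : ℝ) = (p : ℝ) ^ l := by
    rw [Module.card_eq_pow_finrank (K := ZMod p), ZMod.card, finrank_ker_mulVecLin_eq]
    rw [rowSpan] at hcodim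
    rw [hcodim, Nat.cast_pow]
  have hzero : ∀ v : V, d v = 0 → v.1 = fun _ => v.1 (Fin.natAdd n j₀) := by
    intro v hv
    by_contra hne
    have h := hω (v.1 - fun _ => v.1 (Fin.natAdd n j₀)) (V.sub_mem v.2 (hconst _))
      (sub_ne_zero.mpr hne)
    rw [← hshift, hv, hammingNorm_zero] at h
    simp only [Nat.cast_zero] at h
    linarith
  have hker : Nat.card (LinearMap.ker d) = p := by
    have hequiv : Nat.card (LinearMap.ker d) = Nat.card (ZMod p) := by
      refine Nat.card_congr
        { toFun := fun v => v.1.1 (Fin.natAdd n j₀)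
          invFun := fun c => ⟨⟨fun _ => c, hconst c⟩, by
            rw [LinearMap.mem_ker]
            funext i
            simp [d]⟩
          left_inv := fun v => Subtype.ext (Subtype.ext (hzero v.1 v.2).symm)
          right_inv := fun c => rfl }
    rw [hequiv, Nat.card_zmod]
  have hp : (0 : ℝ) < p := by exact_mod_cast (Fact.out : p.Prime).pos
  have hp1 : (1 : ℝ) ≤ p := by exact_mod_cast (Fact.out : p.Prime).one_le
  have hratio : (Nat.card (LinearMap.ker d) : ℝ) / Fintype.card V = (1 / (p : ℝ)) ^ (l - 1) := by
    obtain ⟨l, rfl⟩ := Nat.exists_eq_add_of_le' hl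
    rw [hker, hcardV, Nat.add_sub_cancel, one_div, inv_pow, pow_succ]
    field_simp
  have hmain := abs_bernPi_real_forall_sub_le hq0 hq1 hρ d (B := ρ ^ t) (fun v hv => by
    rw [← Real.rpow_natCast]
    refine Real.rpow_le_rpow_of_exponent_ge hρ0 hρ1.le ?_
    refine (hω (v.1 - fun _ => v.1 (Fin.natAdd n j₀)) (V.sub_mem v.2 (hconst _)) ?_).le
    intro h0
    refine hv ?_
    rw [hshift, h0]
    rfl)
  rw [hset, ← hratio]
  refine hmain.trans (mul_le_of_le_one_right (by positivity) ?_)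
  have : 0 ≤ (Nat.card (LinearMap.ker d) : ℝ) / Fintype.card V := by positivity
  linarith

end Laplacian

/-! ### Choice of the constants -/

theorem exp_rates_le {n a k : ℕ} {p α A B D Z η ε : ℝ} (hp : 2 ≤ p) (hA : 0 < A)
    (hα1 : α ≤ 1) (ha : (a : ℝ) = α * n)
    (hZε : p * Real.exp (-Z) ≤ ε / 2) (hη : η ≤ 1 / 2) (hZη : Z * η ≤ ε / 2)
    (hDη : D * η ≤ B / 4) (hεA : ε ≤ A * α / 4) (hεA' : ε ≤ A / 8) (hεB : ε ≤ B / 4)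
    (hB : Real.exp (-D) * (1 + (p - 1) * Real.exp (-D)) = Real.exp (-B))
    (hkα : (k : ℝ) ≤ α / 2 * n) (hkB : D * k ≤ B / 4 * n) :
    Real.exp (Z * η * n) * (1 + (p - 1) * Real.exp (-Z)) ^ n *
        (Real.exp (-A * (a - k)) +
          Real.exp (-A * ((1 - η) * n)) * Real.exp (Z * η * n) *
            (1 + (p - 1) * Real.exp (-Z)) ^ a +
          Real.exp (-D * ((1 - η) * n - k)) * (1 + (p - 1) * Real.exp (-D)) ^ a) ≤
      3 * Real.exp (-ε * n) := by
  have hn : (0 : ℝ) ≤ n := n.cast_nonneg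
  have han : a ≤ n := by
    have : (a : ℝ) ≤ n := by rw [ha]; nlinarith
    exact_mod_cast this
  have hp1 : 0 ≤ p - 1 := by linarith
  have hZ0 := Real.exp_pos (-Z)
  have hD0 := Real.exp_pos (-D)
  have hs1 : 1 ≤ 1 + (p - 1) * Real.exp (-Z) := by nlinarith
  have hs : (1 + (p - 1) * Real.exp (-Z)) ^ n ≤ Real.exp (ε / 2 * n) := by
    rw [mul_comm (ε / 2), Real.exp_nat_mul]
    refine pow_le_pow_left₀ (by linarith) ?_ _
    have := Real.add_one_le_exp (ε / 2)
    nlinarith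
  have hs' : (1 + (p - 1) * Real.exp (-Z)) ^ a ≤ Real.exp (ε / 2 * n) :=
    (pow_le_pow_right₀ hs1 han).trans hs
  have hz : Real.exp (Z * η * n) ≤ Real.exp (ε / 2 * n) := by
    rw [Real.exp_le_exp]
    exact mul_le_mul_of_nonneg_right hZη hn
  have hpre : Real.exp (Z * η * n) * (1 + (p - 1) * Real.exp (-Z)) ^ n ≤ Real.exp (ε * n) := by
    refine (mul_le_mul hz hs (by positivity) (by positivity)).trans_eq ?_
    rw [← Real.exp_add]
    ring_nf
  have h1 : Real.exp (-A * (a - k)) ≤ Real.exp (-(2 * ε) * n) := by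
    rw [Real.exp_le_exp, ha]
    have : A * k ≤ A * (α / 2 * n) := mul_le_mul_of_nonneg_left hkα hA.le
    nlinarith
  have h2 : Real.exp (-A * ((1 - η) * n)) * Real.exp (Z * η * n) *
      (1 + (p - 1) * Real.exp (-Z)) ^ a ≤ Real.exp (-(2 * ε) * n) := by
    refine (mul_le_mul (mul_le_mul_of_nonneg_left hz (Real.exp_pos _).le) hs'
      (by positivity) (by positivity)).trans ?_
    rw [← Real.exp_add, ← Real.exp_add, Real.exp_le_exp]
    have : A * (1 / 2) * n ≤ A * (1 - η) * n := by
      gcongr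
      linarith
    nlinarith
  have h3 : Real.exp (-D * ((1 - η) * n - k)) * (1 + (p - 1) * Real.exp (-D)) ^ a ≤
      Real.exp (-(2 * ε) * n) := by
    have hr : 1 ≤ 1 + (p - 1) * Real.exp (-D) := by nlinarith
    have hpow : (1 + (p - 1) * Real.exp (-D)) ^ a ≤ (1 + (p - 1) * Real.exp (-D)) ^ n :=
      pow_le_pow_right₀ hr han
    refine (mul_le_mul_of_nonneg_left hpow (Real.exp_pos _).le).trans ?_
    have hsplit : Real.exp (-D * ((1 - η) * n - k)) =
        Real.exp (D * η * n + D * k) * Real.exp (-D) ^ n := by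
      rw [← Real.exp_nat_mul, ← Real.exp_add]
      ring_nf
    rw [hsplit, mul_assoc, ← mul_pow, hB, ← Real.exp_nat_mul, ← Real.exp_add, Real.exp_le_exp]
    have := mul_le_mul_of_nonneg_right hDη hn
    nlinarith
  refine (mul_le_mul hpre (add_le_add (add_le_add h1 h2) h3) (by positivity)
    (Real.exp_pos _).le).trans_eq ?_
  rw [show Real.exp (-ε * n) = Real.exp (ε * n) * Real.exp (-(2 * ε) * n) by
    rw [← Real.exp_add]; ring_nf]
  ring

/-- With exponentially high probability, no nonzero vector with few nonzero entries on the first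
part is orthogonal to all rows of the Laplacian but the last `k`. -/
theorem exists_lapMeasure_real_sparse_le {p : ℕ} [Fact p.Prime] {q : ℝ} (hq0 : 0 ≤ q) (hq1 : q ≤ 1)
    {ρ : ℝ} (hρ0 : 0 < ρ) (hρ1 : ρ < 1)
    (hρ : ∀ z : ZMod p, z ≠ 0 → ‖(q : ℂ) * ZMod.stdAddChar z + ((1 - q : ℝ) : ℂ)‖ ≤ ρ)
    {α : ℝ} (hα0 : 0 < α) (hα1 : α ≤ 1) :
    ∃ δ₀ > (0 : ℝ), ∃ η > (0 : ℝ), ∃ ε > (0 : ℝ), ∃ n₀ : ℕ, δ₀ ≤ α / 2 ∧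
      ∀ n a k : ℕ, n₀ ≤ n → (a : ℝ) = α * n → (k : ℝ) ≤ δ₀ * n →
        (lapMeasure p n a q).real {ω | ∃ (u : Fin n → ZMod p) (w : Fin a → ZMod p),
          (hammingNorm u : ℝ) ≤ η * n ∧ (w = 0 → u ≠ 0) ∧ ω ∈ orthEvent k u w} ≤
        3 * Real.exp (-ε * n) := by
  have hp2 : (2 : ℝ) ≤ p := by exact_mod_cast (Fact.out : p.Prime).two_le
  have hp0 : (0 : ℝ) < p := by linarith
  have hpinv : 1 / (p : ℝ) ≤ 1 / 2 := one_div_le_one_div_of_le (by norm_num) hp2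
  have hpinv0 : 0 < 1 / (p : ℝ) := by positivity
  obtain ⟨A, hA, hAexp⟩ : ∃ A : ℝ, 0 < A ∧ 1 / p + ρ * (1 - 1 / p) = Real.exp (-A) := by
    have hpos : 0 < 1 / p + ρ * (1 - 1 / p) := by nlinarith
    refine ⟨-Real.log (1 / p + ρ * (1 - 1 / p)), ?_, ?_⟩
    · rw [neg_pos]
      exact Real.log_neg hpos (by nlinarith)
    · rw [neg_neg, Real.exp_log hpos]
  obtain ⟨D, hD, hDexp⟩ : ∃ D : ℝ, 0 < D ∧ 6 / 5 * (1 / (p : ℝ)) = Real.exp (-D) := by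
    refine ⟨-Real.log (6 / 5 * (1 / (p : ℝ))), ?_, ?_⟩
    · rw [neg_pos]
      exact Real.log_neg (by positivity) (by linarith)
    · rw [neg_neg, Real.exp_log (by positivity)]
  obtain ⟨B, hB, hBexp⟩ : ∃ B : ℝ, 0 < B ∧
      Real.exp (-D) * (1 + (p - 1) * Real.exp (-D)) = Real.exp (-B) := by
    have hpos : 0 < Real.exp (-D) * (1 + (p - 1) * Real.exp (-D)) := by
      have : (0 : ℝ) ≤ p - 1 := by linarith
      positivity
    refine ⟨-Real.log (Real.exp (-D) * (1 + (p - 1) * Real.exp (-D))), ?_, ?_⟩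
    · rw [neg_pos]
      refine Real.log_neg hpos ?_
      rw [← hDexp]
      have hinv : (p : ℝ) * (1 / p) = 1 := by field_simp
      have : 6 / 5 * (1 / (p : ℝ)) * (1 + (p - 1) * (6 / 5 * (1 / p))) =
          66 / 25 * (1 / p) - 36 / 25 * (1 / (p : ℝ)) ^ 2 := by
        field_simp
        ring
      rw [this]
      nlinarith
    · rw [neg_neg, Real.exp_log hpos]
  obtain ⟨ε, hε, hεA, hεA', hεB⟩ : ∃ ε : ℝ, 0 < ε ∧ ε ≤ A * α / 4 ∧ ε ≤ A / 8 ∧ ε ≤ B / 4 :=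
    ⟨min (A * α / 4) (min (A / 8) (B / 4)), by positivity, min_le_left _ _,
      (min_le_right _ _).trans (min_le_left _ _), (min_le_right _ _).trans (min_le_right _ _)⟩
  obtain ⟨Z, hZ, hZexp⟩ : ∃ Z : ℝ, 0 < Z ∧ p * Real.exp (-Z) ≤ ε / 2 := by
    have hpos : 0 < min (ε / 2 / p) (1 / 2) := by positivity
    refine ⟨-Real.log (min (ε / 2 / p) (1 / 2)), ?_, ?_⟩
    · rw [neg_pos]
      exact Real.log_neg hpos ((min_le_right _ _).trans_lt (by norm_num))
    · rw [neg_neg, Real.exp_log hpos, mul_comm, ← le_div_iff₀ hp0]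
      exact min_le_left _ _
  obtain ⟨η, hη, hη2, hZη, hDη⟩ :
      ∃ η : ℝ, 0 < η ∧ η ≤ 1 / 2 ∧ Z * η ≤ ε / 2 ∧ D * η ≤ B / 4 := by
    refine ⟨min (1 / 2) (min (ε / 2 / Z) (B / 4 / D)), by positivity, min_le_left _ _, ?_, ?_⟩
    · rw [mul_comm, ← le_div_iff₀ hZ]
      exact (min_le_right _ _).trans (min_le_left _ _)
    · rw [mul_comm, ← le_div_iff₀ hD]
      exact (min_le_right _ _).trans (min_le_right _ _)
  obtain ⟨m₀, hm₀⟩ := exists_pow_lt_of_lt_one (y := ρ) (x := 1 / 5 * (1 / (p : ℝ)))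
    (by positivity) hρ1
  refine ⟨min (α / 2) (B / 4 / D), by positivity, η, hη, ε, hε, ⌈m₀ / η⌉₊, min_le_left _ _,
    fun n a k hn ha hk => ?_⟩
  have hn0 : (0 : ℝ) ≤ n := n.cast_nonneg
  have hkα : (k : ℝ) ≤ α / 2 * n := hk.trans (mul_le_mul_of_nonneg_right (min_le_left _ _) hn0)
  have hkB : D * k ≤ B / 4 * n := by
    have h := hk.trans (mul_le_mul_of_nonneg_right (min_le_right _ _) hn0)
    rw [mul_comm, ← le_div_iff₀ hD]
    exact h.trans_eq (by ring)
  have hka : k ≤ a := by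
    have : (k : ℝ) ≤ a := by rw [ha]; nlinarith
    exact_mod_cast this
  refine (sum_lapMeasure_real_orthEvent_le hq0 hq1 hρ0.le hρ1.le hρ hA hAexp.le hD hZ hη2
    (fun m hm => ?_) hka).trans
    (exp_rates_le hp2 hA hα1 ha hZexp hη2 hZη hDη hεA hεA' hεB hBexp hkα hkB)
  have hm₀m : m₀ ≤ m := by
    have h1 : (m₀ : ℝ) / η ≤ n := (Nat.le_ceil _).trans (by exact_mod_cast hn)
    rw [div_le_iff₀ hη, mul_comm] at h1
    exact_mod_cast h1.trans hm
  rw [← hDexp]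
  have := pow_le_pow_of_le_one hρ0.le hρ1.le hm₀m
  linarith

/-- **Rank evolution.** For every sufficiently small `δ > 0` there are `C, c > 0` such that
for all `n` and every `1 ≤ k ≤ δn` the following holds: with `W` the span of the first
`(1+α)n - k` rows of `M` and `Y` the next row, there is an event `E` determined by the first
`(1+α)n - k` rows, of probability at least `1 - C·exp(-cn)`, such that for every `l ≥ 1` with
`P(E ∩ {codim W = l}) > 0` one has `|P(Y ∈ W | E ∩ {codim W = l}) - p^{-(l-1)}| ≤ C·exp(-cn)`. -/
theorem rank_evolution
    (p : ℕ) (hp : p.Prime) (q : ℝ) (hq0 : 0 < q) (hq1 : q < 1)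
    (α : ℚ) (hα1 : 1 / (p : ℚ) < α) (hα2 : α ≤ 1) :
    ∃ δ₀ > (0 : ℝ), ∀ δ : ℝ, 0 < δ → δ ≤ δ₀ →
      ∃ C > (0 : ℝ), ∃ c > (0 : ℝ), ∀ n : ℕ, ∀ hn : 0 < n, ∀ a : ℕ, (a : ℚ) = α * n →
        ∀ k : ℕ, ∀ hk : 1 ≤ k, (k : ℝ) ≤ δ * n →
          ∃ E : Set (LapIdx n a → ZMod p),
            (∃ S : Set (Matrix (Fin (n + a - k)) (Fin (n + a)) (ZMod p)),
              E = (fun ω => firstRows p n a (n + a - k) (by omega) ω) ⁻¹' S) ∧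
            1 - C * Real.exp (-c * n) ≤ ((lapMeasure p n a q) E).toReal ∧
            ∀ l : ℕ, 1 ≤ l →
              (lapMeasure p n a q)
                (E ∩ {ω | (n + a) - Module.finrank (ZMod p)
                  (rowSpan p n a (n + a - k) (by omega) ω) = l}) ≠ 0 →
              |((lapMeasure p n a q)
                  ((E ∩ {ω | (n + a) - Module.finrank (ZMod p)
                      (rowSpan p n a (n + a - k) (by omega) ω) = l}) ∩
                    {ω | lapM p n a ω ⟨n + a - k, by omega⟩ ∈
                      rowSpan p n a (n + a - k) (by omega) ω})).toReal /
                ((lapMeasure p n a q)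
                  (E ∩ {ω | (n + a) - Module.finrank (ZMod p)
                      (rowSpan p n a (n + a - k) (by omega) ω) = l})).toReal -
                (1 / (p : ℝ)) ^ (l - 1)| ≤ C * Real.exp (-c * n) := by
  have : Fact p.Prime := ⟨hp⟩
  have hprob := bern_isProbabilityMeasure (p := p) hq0.le hq1.le
  have hα0 : (0 : ℝ) < α := by
    have h0 : (0 : ℚ) < 1 / p := by
      have : (0 : ℚ) < p := by exact_mod_cast hp.pos
      positivity
    exact_mod_cast h0.trans hα1
  have hα2' : (α : ℝ) ≤ 1 := by exact_mod_cast hα2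
  obtain ⟨ρ, hρ0, hρ1, hρ⟩ := exists_norm_bern_charFun_le (p := p) hq0 hq1
  obtain ⟨δ₀, hδ₀, η, hη, ε, hε, n₀, hδα, hsparse⟩ :=
    exists_lapMeasure_real_sparse_le hq0.le hq1.le hρ0 hρ1 hρ hα0 hα2'
  refine ⟨δ₀, hδ₀, fun δ _ hδ => ?_⟩
  have hlogρ : 0 < -Real.log ρ := neg_pos.mpr (Real.log_neg hρ0 hρ1)
  set c := min ε (η * -Real.log ρ)
  have hc : 0 < c := by positivity
  refine ⟨3 + Real.exp (c * n₀), by positivity, c, hc, fun n hn a ha k hk1 hkδ => ?_⟩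
  have hn0 : (0 : ℝ) < n := by exact_mod_cast hn
  have hprobM : IsProbabilityMeasure (lapMeasure p n a q) := by
    rw [lapMeasure]
    infer_instance
  have ha' : (a : ℝ) = α * n := by exact_mod_cast ha
  have hk : (k : ℝ) ≤ δ₀ * n := hkδ.trans (mul_le_mul_of_nonneg_right hδ hn0.le)
  have hka : k ≤ a := by
    have : (k : ℝ) ≤ a := by rw [ha']; nlinarith
    exact_mod_cast this
  have hE3 : 3 * Real.exp (-c * n) ≤ (3 + Real.exp (c * n₀)) * Real.exp (-c * n) := by
    have h1 := Real.exp_pos (c * n₀)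
    have h2 := Real.exp_pos (-c * n)
    nlinarith
  let S : Set (Matrix (Fin (n + a - k)) (Fin (n + a)) (ZMod p)) :=
    {A | ∀ v ∈ LinearMap.ker A.mulVecLin, v ≠ 0 →
      η * n < hammingNorm fun i : Fin n => v (Fin.castAdd a i)}
  let E : Set (LapIdx n a → ZMod p) :=
    (fun ω => firstRows p n a (n + a - k) (Nat.sub_le _ _) ω) ⁻¹' S
  refine ⟨E, ⟨S, rfl⟩, ?_, fun l hl hne => ?_⟩
  · by_cases hnn : n₀ ≤ n
    · have hcompl : Eᶜ ⊆ {ω | ∃ (u : Fin n → ZMod p) (w : Fin a → ZMod p),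
          (hammingNorm u : ℝ) ≤ η * n ∧ (w = 0 → u ≠ 0) ∧ ω ∈ orthEvent k u w} := by
        intro ω hω
        simp only [E, S, Set.mem_compl_iff, Set.mem_preimage, Set.mem_ofPred_eq, not_forall,
          not_lt] at hω
        obtain ⟨v, hv, hv0, hvn⟩ := hω
        refine ⟨fun i => v (Fin.castAdd a i), fun j => v (Fin.natAdd n j), hvn, ?_,
          (mem_ker_firstRows_iff hka ω v).mp hv⟩
        intro hw hu
        refine hv0 (funext fun r => ?_)
        refine Fin.addCases (fun i => congrFun hu i) (fun j => congrFun hw j) r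
      have hbad := (measureReal_mono (μ := lapMeasure p n a q) hcompl (measure_ne_top _ _)).trans
        (hsparse n a k hnn ha' hk)
      rw [measureReal_compl E.toFinite.measurableSet, probReal_univ] at hbad
      have hexp : Real.exp (-ε * n) ≤ Real.exp (-c * n) := by
        rw [Real.exp_le_exp]
        have : c * n ≤ ε * n := mul_le_mul_of_nonneg_right (min_le_left _ _) hn0.le
        linarith
      rw [← measureReal_def]
      linarith
    · have hbig : 1 ≤ Real.exp (c * n₀) * Real.exp (-c * n) := by
        rw [← Real.exp_add, Real.one_le_exp_iff]
        have : (n : ℝ) ≤ n₀ := by exact_mod_cast (not_le.mp hnn).le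
        nlinarith
      have h3 := Real.exp_pos (-c * n)
      refine le_trans ?_ ENNReal.toReal_nonneg
      nlinarith
  · set F := E ∩ {ω | (n + a) - Module.finrank (ZMod p)
      (rowSpan p n a (n + a - k) (Nat.sub_le _ _) ω) = l}
    set G : Set (LapIdx n a → ZMod p) := {ω | lapM p n a ω ⟨n + a - k, by omega⟩ ∈
      rowSpan p n a (n + a - k) (Nat.sub_le _ _) ω}
    let e : Fin n → LapIdx n a := fun i => .inr (⟨a - k, by omega⟩, i)
    have he : Function.Injective e := by
      intro i i' h
      simpa [e] using h
    have hrows : ∀ (ω : LapIdx n a → ZMod p) (y : Fin n → ZMod p),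
        firstRows p n a (n + a - k) (Nat.sub_le _ _) (Function.extend e y ω) =
          firstRows p n a (n + a - k) (Nat.sub_le _ _) ω := by
      intro ω y
      funext r
      refine lapM_extend (e := e) (fun _ => rfl) ω y ?_
      simp only [Fin.val_castLE]
      omega
    have hspan : ∀ (ω : LapIdx n a → ZMod p) (y : Fin n → ZMod p),
        rowSpan p n a (n + a - k) (Nat.sub_le _ _) (Function.extend e y ω) =
          rowSpan p n a (n + a - k) (Nat.sub_le _ _) ω := by
      intro ω y
      rw [rowSpan, hrows, rowSpan]
    have hF : ∀ ω y, Function.extend e y ω ∈ F ↔ ω ∈ F := by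
      intro ω y
      simp only [F, E, Set.mem_inter_iff, Set.mem_preimage, Set.mem_ofPred_eq, hrows]
      rw [hspan ω y]
    have hcond := abs_bernPi_real_inter_sub_le hq0.le hq1.le he (F := F) (G := G)
      (s := (1 / (p : ℝ)) ^ (l - 1)) (B := ρ ^ (η * n)) hF (fun ω hω => by
        have h := abs_bernPi_real_mem_rowSpan_sub_le hq0.le hq1.le hρ0 hρ1 hρ hk1 hka
          (t := η * n) (by positivity) (ω := ω) hω.1 (e := e) (fun _ => rfl) hl hω.2
        simpa only [G, Set.mem_ofPred_eq, hspan] using h)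
    have hFpos : 0 < (lapMeasure p n a q F).toReal :=
      ENNReal.toReal_pos hne (measure_ne_top _ _)
    have hρn : ρ ^ (η * n) ≤ Real.exp (-c * n) := by
      rw [Real.rpow_def_of_pos hρ0, Real.exp_le_exp]
      have : c * n ≤ η * -Real.log ρ * n := mul_le_mul_of_nonneg_right (min_le_right _ _) hn0.le
      linarith
    have hexp := Real.exp_pos (-c * n)
    change |(lapMeasure p n a q (F ∩ G)).toReal / (lapMeasure p n a q F).toReal - _| ≤ _
    change |(lapMeasure p n a q (F ∩ G)).toReal - _ * (lapMeasure p n a q F).toReal| ≤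
      _ * (lapMeasure p n a q F).toReal at hcond
    rw [div_sub' hFpos.ne', abs_div, abs_of_pos hFpos, div_le_iff₀ hFpos, mul_comm _ (_ ^ _)]
    refine hcond.trans (mul_le_mul_of_nonneg_right ?_ hFpos.le)
    linarith
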